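/- Set R₀ := −(3/5) M²/h_M^r > 0. Let ρ ∈ F_M^r be spherically symmetric, let R > 0, and put m := ∫_{|x|≥R} ρ(x) dx. Then H_C^r(ρ) ≥ h_M^r + (1/R₀ − 1/R)(M − m) m. Moreover, if R > R₀, then for any spherically symmetric minimizing sequence (ρ_i) ⊂ F_M^r of H_C^r one has lim_{i→∞} ∫_{|x|≥R} ρ_i(x) dx = 0. -/

import Mathlib

open MeasureTheory Real Filter Topology

noncomputable section

abbrev Space : Type := EuclideanSpace ℝ (Fin 3)

/-- Induced gravitational potential `U_ρ = -ρ ∗ 1/|·|`. -/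
def Upot (ρ : Space → ℝ) : Space → ℝ := fun x => - ∫ y : Space, ρ y / ‖x - y‖

/-- Induced gravitational field `∇U_ρ`. -/
def gradU (ρ : Space → ℝ) : Space → Space := fun x => gradient (Upot ρ) x

/-- Potential energy. -/
def Epot (ρ : Space → ℝ) : ℝ :=
  -(1/2) * ∫ x : Space, ∫ y : Space, ρ x * ρ y / ‖x - y‖

/-- The reduced energy-Casimir functional `H_C^r(ρ) = ∫ Φ(ρ) + E_pot(ρ)`. -/
def HCr (Φ : ℝ → ℝ) (ρ : Space → ℝ) : ℝ := (∫ x : Space, Φ (ρ x)) + Epot ρ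

/-- The reduced constraint set `F_M^r = {ρ ∈ L¹₊ : ∫ Φ(ρ) < ∞, ∫ ρ = M}`. -/
def FMr (Φ : ℝ → ℝ) (M : ℝ) : Set (Space → ℝ) :=
  {ρ | (∀ x, 0 ≤ ρ x) ∧ Integrable ρ ∧
       Integrable (fun x => Φ (ρ x)) ∧ (∫ x : Space, ρ x) = M}

/-- The infimum `h_M^r` of `H_C^r` over `F_M^r`. -/
def hMr (Φ : ℝ → ℝ) (M : ℝ) : ℝ := sInf (HCr Φ '' FMr Φ M)

/-- Assumptions on `Φ`: `Φ ∈ C¹([0,∞))` with derivative `Φ'`, `Φ(0) = Φ'(0) = 0`,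
strictly convex, `Φ(r) ≥ C r^{1+1/n}` for large `r` with `0 < n < 3`, and
`Φ(r) ≤ C r^{1+1/n'}` for small `r` with `0 < n' < 3`. -/
structure PhiHyp (Φ Φ' : ℝ → ℝ) (n n' : ℝ) : Prop where
  n_pos : 0 < n
  n_lt_three : n < 3
  n'_pos : 0 < n'
  n'_lt_three : n' < 3
  hasDeriv : ∀ r ∈ Set.Ici (0:ℝ), HasDerivWithinAt Φ (Φ' r) (Set.Ici 0) r
  contDeriv : ContinuousOn Φ' (Set.Ici 0)
  zero : Φ 0 = 0
  derivZero : Φ' 0 = 0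
  strictConvex : StrictConvexOn ℝ (Set.Ici 0) Φ
  growth : ∃ C > (0:ℝ), ∃ r₁ : ℝ, ∀ r : ℝ, r₁ ≤ r → C * r ^ (1 + 1/n) ≤ Φ r
  small : ∃ C > (0:ℝ), ∃ r₁ > (0:ℝ), ∀ r : ℝ, 0 ≤ r → r ≤ r₁ → Φ r ≤ C * r ^ (1 + 1/n')

/-- The radius `R₀ = -(3/5) M²/h_M^r`. -/
def R0 (Φ : ℝ → ℝ) (M : ℝ) : ℝ := -(3/5) * M^2 / hMr Φ M

open scoped ENNReal RealInnerProductSpace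

lemma lintegral_add_sq_plane {g : ℝ → ℝ≥0∞} (hg : Measurable g) :
    ∫⁻ q : ℝ × ℝ, g (q.1 ^ 2 + q.2 ^ 2) = ENNReal.ofReal π * ∫⁻ t in Set.Ioi 0, g t := by
  rw [← lintegral_comp_polarCoord_symm]
  have h1 : ∀ p : ℝ × ℝ, (polarCoord.symm p).1 ^ 2 + (polarCoord.symm p).2 ^ 2 = p.1 ^ 2 := by
    intro p
    simp only [polarCoord_symm_apply]
    nlinarith [Real.sin_sq_add_cos_sq p.2]
  simp_rw [h1]
  rw [polarCoord_target, Measure.volume_eq_prod, setLIntegral_prod _ (by fun_prop)]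
  have h2 : Set.Ioi (0 : ℝ) = (fun p : ℝ => p ^ 2) '' Set.Ioi 0 := by
    ext t
    constructor
    · intro ht
      exact ⟨√t, Real.sqrt_pos.2 ht, Real.sq_sqrt (le_of_lt ht)⟩
    · rintro ⟨p, hp, rfl⟩
      exact pow_pos (Set.mem_Ioi.1 hp) 2
  conv_rhs => rw [h2]
  rw [lintegral_image_eq_lintegral_deriv_mul_of_monotoneOn (f' := fun p => 2 * p)
    measurableSet_Ioi, ← lintegral_const_mul _ (by fun_prop)]
  · refine setLIntegral_congr_fun measurableSet_Ioi fun p hp => ?_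
    have hp' : (0 : ℝ) < p := hp
    simp only [smul_eq_mul, lintegral_const, Measure.restrict_apply MeasurableSet.univ,
      Set.univ_inter, Real.volume_Ioo]
    rw [mul_right_comm, ← mul_assoc, ← ENNReal.ofReal_mul hp'.le, ← ENNReal.ofReal_mul pi_pos.le]
    congr 2
    ring
  · intro p _
    simpa using (hasDerivAt_pow 2 p).hasDerivWithinAt
  · intro a ha b _ hab
    exact pow_le_pow_left₀ (le_of_lt ha) hab 2

lemma exists_measurePreserving_axis {e : Space} (he : ‖e‖ = 1) :
    ∃ φ : Space → ℝ × ℝ × ℝ, MeasurePreserving φ ∧ (∀ y, (φ y).1 = ⟪e, y⟫) ∧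
      ∀ y, ‖y‖ ^ 2 = (φ y).1 ^ 2 + ((φ y).2.1 ^ 2 + (φ y).2.2 ^ 2) := by
  have ho : Orthonormal ℝ ((({0} : Set (Fin 3))).domRestrict fun _ => e) := by
    refine ⟨fun _ => by simpa using he, fun i j hij => ?_⟩
    exact absurd (Subsingleton.elim i j) hij
  obtain ⟨b, hb⟩ := ho.exists_orthonormalBasis_extension_of_card_eq (by simp)
  have hb0 : b 0 = e := hb 0 rfl
  refine ⟨_, ((MeasurePreserving.id volume).prod (volume_preserving_finTwoArrow ℝ)).comp
    ((volume_preserving_piFinSuccAbove (fun _ : Fin 3 => ℝ) 0).comp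
      ((PiLp.volume_preserving_ofLp (Fin 3)).comp b.measurePreserving_repr)), ?_, ?_⟩
  · intro y
    simp [MeasurableEquiv.piFinSuccAbove, b.repr_apply_apply, hb0]
  · intro y
    rw [← b.repr.norm_map y, EuclideanSpace.norm_sq_eq, Fin.sum_univ_three]
    simp [MeasurableEquiv.piFinSuccAbove, MeasurableEquiv.finTwoArrow, Fin.tail, add_assoc]

lemma lintegral_norm_sq_inner {e : Space} (he : ‖e‖ = 1) {F : ℝ → ℝ → ℝ≥0∞}
    (hF : Measurable (Function.uncurry F)) :
    ∫⁻ y : Space, F (‖y‖ ^ 2) ⟪e, y⟫ =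
      ENNReal.ofReal π * ∫⁻ w, ∫⁻ z in Set.Ioo (-√w) √w, F w z := by
  obtain ⟨φ, hφ, h1, h2⟩ := exists_measurePreserving_axis he
  have hm {α : Type} [MeasurableSpace α] {f g : α → ℝ} (hf : Measurable f) (hg : Measurable g) :
      Measurable fun p => F (f p) (g p) := hF.comp (hf.prodMk hg)
  simp_rw [h2, ← h1]
  rw [hφ.lintegral_comp (f := fun p => F (p.1 ^ 2 + (p.2.1 ^ 2 + p.2.2 ^ 2)) p.1)
    (hm (by fun_prop) (by fun_prop)), Measure.volume_eq_prod,
    lintegral_prod _ (hm (by fun_prop) (by fun_prop)).aemeasurable]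
  have h3 : ∀ z : ℝ, ∫⁻ q : ℝ × ℝ, F (z ^ 2 + (q.1 ^ 2 + q.2 ^ 2)) z =
      ENNReal.ofReal π * ∫⁻ w, (Set.Ioi (z ^ 2)).indicator (fun w => F w z) w := by
    intro z
    rw [lintegral_add_sq_plane (g := fun t => F (z ^ 2 + t) z) (hm (by fun_prop) (by fun_prop)),
      ← lintegral_indicator measurableSet_Ioi,
      ← lintegral_add_left_eq_self (fun w => (Set.Ioi (z ^ 2)).indicator (fun w => F w z) w)
        (z ^ 2)]
    congr 2
    ext t
    simp [Set.indicator_apply]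
  have hm2 : Measurable fun p : ℝ × ℝ =>
      (Set.Ioi (p.1 ^ 2)).indicator (fun w => F w p.1) p.2 := by
    have : MeasurableSet {p : ℝ × ℝ | p.1 ^ 2 < p.2} :=
      measurableSet_lt (by fun_prop) (by fun_prop)
    exact (hm measurable_snd measurable_fst).indicator this
  simp_rw [h3]
  rw [lintegral_const_mul _ hm2.lintegral_prod_right', lintegral_lintegral_swap hm2.aemeasurable]
  congr 2
  ext w
  rw [← lintegral_indicator measurableSet_Ioo]
  congr 1
  ext z
  simp only [Set.indicator_apply, Set.mem_Ioi, Set.mem_Ioo, ← abs_lt, Real.lt_sqrt (abs_nonneg z),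
    sq_abs]

lemma setLIntegral_inv_sqrt {r s : ℝ} (hr : 0 ≤ r) (hs : 0 < s) (hrs : r ≠ s) :
    ∫⁻ z in Set.Ioo (-r) r, ENNReal.ofReal (1 / √(r ^ 2 + s ^ 2 - 2 * s * z)) =
      ∫⁻ _ in Set.Ioo (-r) r, ENNReal.ofReal (1 / max s r) := by
  have hpos : ∀ z ∈ Set.uIcc (-r) r, 0 < r ^ 2 + s ^ 2 - 2 * s * z := by
    intro z hz
    rw [Set.uIcc_of_le (by linarith)] at hz
    nlinarith [sq_pos_of_ne_zero (sub_ne_zero.2 hrs), mul_le_mul_of_nonneg_left hz.2 hs.le]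
  have hcont : ContinuousOn (fun z => 1 / √(r ^ 2 + s ^ 2 - 2 * s * z)) (Set.uIcc (-r) r) := by
    refine ContinuousOn.div continuousOn_const (by fun_prop) fun z hz => ?_
    exact (Real.sqrt_pos.2 (hpos z hz)).ne'
  have hint := intervalIntegral.integral_eq_sub_of_hasDerivAt
    (f := fun z => -(1 / s) * √(r ^ 2 + s ^ 2 - 2 * s * z)) (fun z hz => by
      have h1 : HasDerivAt (fun z => r ^ 2 + s ^ 2 - 2 * s * z) (-(2 * s)) z := by
        simpa using ((hasDerivAt_id z).const_mul (2 * s)).const_sub (r ^ 2 + s ^ 2)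
      convert! (h1.sqrt (hpos z hz).ne').const_mul (-(1 / s)) using 1
      have := (Real.sqrt_pos.2 (hpos z hz)).ne'
      field_simp) hcont.intervalIntegrable
  have hval : ∫ z in (-r)..r, 1 / √(r ^ 2 + s ^ 2 - 2 * s * z) = 2 * r * (1 / max s r) := by
    rw [hint, show r ^ 2 + s ^ 2 - 2 * s * r = (r - s) ^ 2 by ring,
      show r ^ 2 + s ^ 2 - 2 * s * -r = (r + s) ^ 2 by ring, Real.sqrt_sq_eq_abs,
      Real.sqrt_sq (by linarith)]
    rcases le_total r s with h | h
    · rw [max_eq_left h, abs_of_nonpos (by linarith)]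
      field_simp
      ring
    · have : 0 < r := hs.trans_le h
      rw [max_eq_right h, abs_of_nonneg (by linarith)]
      field_simp
      ring
  rw [Measure.restrict_congr_set Ioo_ae_eq_Ioc, ← ofReal_integral_eq_lintegral_ofReal
    ((intervalIntegrable_iff_integrableOn_Ioc_of_le (by linarith)).1 hcont.intervalIntegrable)
    (Eventually.of_forall fun z => by positivity),
    ← intervalIntegral.integral_of_le (by linarith), hval]
  rw [ENNReal.ofReal_mul (by linarith), lintegral_const, Measure.restrict_apply MeasurableSet.univ,
    Set.univ_inter, Real.volume_Ioc, mul_comm, sub_neg_eq_add, ← two_mul]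

/-- Newton's shell theorem, for a radial density. -/
lemma lintegral_radial_mul_inv_norm_sub {f : ℝ → ℝ≥0∞} (hf : Measurable f) {x : Space}
    (hx : x ≠ 0) :
    ∫⁻ y : Space, f (‖y‖ ^ 2) * ENNReal.ofReal (1 / ‖x - y‖) =
      ∫⁻ y : Space, f (‖y‖ ^ 2) * ENNReal.ofReal (1 / max ‖x‖ ‖y‖) := by
  set s := ‖x‖ with hs
  have hs0 : 0 < s := norm_pos_iff.2 hx
  have he : ‖s⁻¹ • x‖ = 1 := by
    rw [norm_smul, norm_inv, norm_norm, inv_mul_cancel₀ hs0.ne']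
  have h1 : ∀ y : Space, ‖x - y‖ = √(‖y‖ ^ 2 + s ^ 2 - 2 * s * ⟪s⁻¹ • x, y⟫) := by
    intro y
    rw [← Real.sqrt_sq (norm_nonneg (x - y)), norm_sub_sq_real, real_inner_smul_left]
    congr 1
    field_simp
    ring
  have h2 : ∀ y : Space, max s ‖y‖ = max s √(‖y‖ ^ 2) := fun y => by
    rw [Real.sqrt_sq (norm_nonneg y)]
  simp_rw [h1, h2]
  rw [lintegral_norm_sq_inner he
      (F := fun w z => f w * ENNReal.ofReal (1 / √(w + s ^ 2 - 2 * s * z)))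
      (by unfold Function.uncurry; fun_prop),
    lintegral_norm_sq_inner he (F := fun w _ => f w * ENNReal.ofReal (1 / max s √w))
      (by unfold Function.uncurry; fun_prop)]
  congr 1
  refine lintegral_congr_ae ?_
  filter_upwards [Measure.ae_ne volume (s ^ 2)] with w hw
  rcases le_or_gt w 0 with h0 | h0
  · simp [Real.sqrt_eq_zero_of_nonpos h0]
  rw [lintegral_const_mul _ (by fun_prop), lintegral_const_mul _ (by fun_prop)]
  congr 1
  have := setLIntegral_inv_sqrt (Real.sqrt_nonneg w) hs0 (fun h => hw (by
    rw [← h, Real.sq_sqrt h0.le]))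
  rwa [Real.sq_sqrt h0.le] at this

lemma exists_measurable_radial {ρ : Space → ℝ} (hρ : AEStronglyMeasurable ρ)
    (hsymm : ∀ x y : Space, ‖x‖ = ‖y‖ → ρ x = ρ y) :
    ∃ f : ℝ → ℝ, Measurable f ∧ ρ =ᵐ[volume] fun y => f (‖y‖ ^ 2) := by
  obtain ⟨e, he⟩ := exists_norm_eq Space zero_le_one
  have hP := (volume : Measure Space).measurePreserving_homeomorphUnitSphereProd
  have hE := MeasurableEmbedding.subtype_coe (measurableSet_singleton (0 : Space)).compl
  have h0 : AEStronglyMeasurable (fun y : ({0}ᶜ : Set Space) => ρ y)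
      ((volume : Measure Space).comap (↑)) := by
    refine AEStronglyMeasurable.comp_aemeasurable ?_ hE.measurable.aemeasurable
    rw [hE.map_comap]
    exact hρ.restrict
  have h1 : AEStronglyMeasurable (fun p : Metric.sphere (0 : Space) 1 × Set.Ioi (0 : ℝ) =>
      ρ ((p.2 : ℝ) • e)) ((volume : Measure Space).toSphere.prod
        (Measure.volumeIoiPow (Module.finrank ℝ Space - 1))) := by
    rw [← hP.aestronglyMeasurable_comp_iff (Homeomorph.measurableEmbedding _)]
    refine h0.congr (Eventually.of_forall fun y => hsymm _ _ ?_)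
    simp [norm_smul, he]
  have : (ae (volume : Measure Space).toSphere).NeBot := ae_neBot.2 (Measure.toSphere_ne_zero _)
  obtain ⟨_, h2⟩ := h1.prodMk_left.exists
  obtain ⟨k, hk, hkeq⟩ := h2.aemeasurable
  obtain ⟨f, hf, hfk⟩ := (MeasurableEmbedding.subtype_coe
    (measurableSet_Ioi (a := (0 : ℝ)))).exists_measurable_extend hk fun _ => ⟨0⟩
  refine ⟨fun t => f √t, by fun_prop, ?_⟩
  have h3 := hP.quasiMeasurePreserving.ae (Measure.quasiMeasurePreserving_snd.ae hkeq)
  have h4 : ∀ᵐ y : ({0}ᶜ : Set Space) ∂((volume : Measure Space).comap (↑)),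
      ρ y = f √(‖(y : Space)‖ ^ 2) := by
    filter_upwards [h3] with y hy
    rw [← hfk] at hy
    rw [Real.sqrt_sq (norm_nonneg _)]
    refine (hsymm _ _ ?_).trans (hy.trans ?_)
    · simp [norm_smul, he]
    · simp
  have h5 := (hE.ae_map_iff (p := fun y => ρ y = f √(‖y‖ ^ 2))).2 h4
  rw [hE.map_comap, Subtype.range_coe, restrict_compl_singleton] at h5
  exact h5

lemma potential_bound {σ : Space → ℝ} (h0 : ∀ x, 0 ≤ σ x) (hσ : Integrable σ)
    (hsymm : ∀ x y : Space, ‖x‖ = ‖y‖ → σ x = σ y) {x : Space} (hx : x ≠ 0) {c : ℝ} (hc : 0 < c)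
    (hsupp : ∀ y, σ y ≠ 0 → c ≤ max ‖x‖ ‖y‖) :
    Integrable (fun y => σ y / ‖x - y‖) ∧ ∫ y, σ y / ‖x - y‖ ≤ (∫ y, σ y) / c := by
  obtain ⟨f, hf, hfσ⟩ := exists_measurable_radial hσ.aestronglyMeasurable hsymm
  have hmeas : AEStronglyMeasurable (fun y => σ y / ‖x - y‖) :=
    (hσ.aestronglyMeasurable.aemeasurable.div
      (by fun_prop : Measurable fun y => ‖x - y‖).aemeasurable).aestronglyMeasurable
  have hle : ∫⁻ y, ENNReal.ofReal (σ y / ‖x - y‖) ≤ ENNReal.ofReal ((∫ y, σ y) / c) := by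
    calc ∫⁻ y, ENNReal.ofReal (σ y / ‖x - y‖)
        = ∫⁻ y, ENNReal.ofReal (f (‖y‖ ^ 2)) * ENNReal.ofReal (1 / ‖x - y‖) := by
          refine lintegral_congr_ae ?_
          filter_upwards [hfσ] with y hy
          rw [div_eq_mul_one_div, ENNReal.ofReal_mul (h0 y), hy]
      _ = ∫⁻ y, ENNReal.ofReal (f (‖y‖ ^ 2)) * ENNReal.ofReal (1 / max ‖x‖ ‖y‖) :=
          lintegral_radial_mul_inv_norm_sub (f := fun t => ENNReal.ofReal (f t)) (by fun_prop) hx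
      _ = ∫⁻ y, ENNReal.ofReal (σ y * (1 / max ‖x‖ ‖y‖)) := by
          refine lintegral_congr_ae ?_
          filter_upwards [hfσ] with y hy
          rw [ENNReal.ofReal_mul (h0 y), hy]
      _ ≤ ∫⁻ y, ENNReal.ofReal (σ y / c) := by
          refine lintegral_mono fun y => ENNReal.ofReal_le_ofReal ?_
          rw [div_eq_mul_one_div (σ y) c]
          by_cases hy : σ y = 0
          · simp [hy]
          · exact mul_le_mul_of_nonneg_left (one_div_le_one_div_of_le hc (hsupp y hy)) (h0 y)
      _ = ENNReal.ofReal ((∫ y, σ y) / c) := by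
          rw [← ofReal_integral_eq_lintegral_ofReal (hσ.div_const c)
            (Eventually.of_forall fun y => div_nonneg (h0 y) hc.le), integral_div]
  have hnn : 0 ≤ᵐ[volume] fun y => σ y / ‖x - y‖ :=
    Eventually.of_forall fun y => div_nonneg (h0 y) (norm_nonneg _)
  refine ⟨⟨hmeas, (hasFiniteIntegral_iff_ofReal hnn).2 (hle.trans_lt ENNReal.ofReal_lt_top)⟩, ?_⟩
  rw [integral_eq_lintegral_of_nonneg_ae hnn hmeas]
  exact ENNReal.toReal_le_of_le_ofReal (div_nonneg (integral_nonneg h0) hc.le) hle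

lemma PhiHyp.nonneg {Φ Φ' : ℝ → ℝ} {n n' : ℝ} (hΦ : PhiHyp Φ Φ' n n') {r : ℝ} (hr : 0 ≤ r) :
    0 ≤ Φ r := by
  by_contra! hneg
  have hr0 : 0 < r := lt_of_le_of_ne hr (by rintro rfl; exact hneg.ne hΦ.zero)
  have h := hΦ.strictConvex.convexOn.le_slope_of_hasDerivWithinAt Set.self_mem_Ici hr hr0
    (hΦ.hasDeriv 0 Set.self_mem_Ici)
  rw [hΦ.derivZero, slope_def_field, hΦ.zero, sub_zero, sub_zero] at h
  exact (div_neg_of_neg_of_pos hneg hr0).not_ge h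

lemma Epot_comp_smul (ρ : Space → ℝ) {b : ℝ} (hb : 0 < b) :
    Epot (fun x => ρ (b • x)) = (b ^ 5)⁻¹ * Epot ρ := by
  have h1 : ∀ x y : Space, ρ (b • x) * ρ (b • y) / ‖x - y‖ =
      b * (ρ (b • x) * ρ (b • y) / ‖b • x - b • y‖) := by
    intro x y
    rw [← smul_sub, norm_smul, Real.norm_of_nonneg hb.le, mul_div_assoc',
      mul_div_mul_left _ _ hb.ne']
  have h2 : ∀ x : Space, ∫ y : Space, ρ (b • x) * ρ (b • y) / ‖b • x - b • y‖ =
      (b ^ 3)⁻¹ * ∫ y : Space, ρ (b • x) * ρ y / ‖b • x - y‖ := by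
    intro x
    have := Measure.integral_comp_smul_of_nonneg (volume : Measure Space)
      (fun y => ρ (b • x) * ρ y / ‖b • x - y‖) b (hR := hb.le)
    simpa using this
  have h3 := Measure.integral_comp_smul_of_nonneg (volume : Measure Space)
    (fun x => ∫ y : Space, ρ x * ρ y / ‖x - y‖) b (hR := hb.le)
  simp only [finrank_euclideanSpace, Fintype.card_fin, smul_eq_mul] at h3
  unfold Epot
  simp_rw [h1, integral_const_mul, h2]
  rw [integral_const_mul, h3]
  field_simp

/-- Scaling bound: a density of mass `b³ M` with `b ≤ 1` has energy at least `b⁵ h_M^r`. -/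
lemma pow_five_mul_hMr_le {Φ : ℝ → ℝ} (hΦ : ∀ r, 0 ≤ r → 0 ≤ Φ r) {M : ℝ}
    (hbdd : BddBelow (HCr Φ '' FMr Φ M)) {b : ℝ} (hb : 0 < b) (hb1 : b ≤ 1) {ρ : Space → ℝ}
    (hρ : ρ ∈ FMr Φ (b ^ 3 * M)) : b ^ 5 * hMr Φ M ≤ HCr Φ ρ := by
  obtain ⟨h0, hi, hΦi, hmass⟩ := hρ
  have hscale (g : Space → ℝ) : ∫ x, g (b • x) = (b ^ 3)⁻¹ * ∫ x, g x := by
    have := Measure.integral_comp_smul_of_nonneg (volume : Measure Space) g b (hR := hb.le)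
    simpa using this
  have hmem : (fun x => ρ (b • x)) ∈ FMr Φ M := by
    refine ⟨fun x => h0 _, hi.comp_smul hb.ne', hΦi.comp_smul hb.ne', ?_⟩
    rw [hscale, hmass]
    field_simp
  have h1 : hMr Φ M ≤ HCr Φ (fun x => ρ (b • x)) := csInf_le hbdd ⟨_, hmem, rfl⟩
  unfold HCr at h1 ⊢
  rw [hscale (fun x => Φ (ρ x)), Epot_comp_smul _ hb] at h1
  have hP : 0 ≤ ∫ x, Φ (ρ x) := integral_nonneg fun x => hΦ _ (h0 x)
  have hb2 : b ^ 2 ≤ 1 := pow_le_one₀ hb.le hb1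
  calc b ^ 5 * hMr Φ M
      ≤ b ^ 5 * ((b ^ 3)⁻¹ * (∫ x, Φ (ρ x)) + (b ^ 5)⁻¹ * Epot ρ) := by gcongr
    _ = b ^ 2 * (∫ x, Φ (ρ x)) + Epot ρ := by field_simp
    _ ≤ (∫ x, Φ (ρ x)) + Epot ρ := by nlinarith

/-- Splitting of the potential energy of a spherically symmetric density at radius `R`. -/
lemma Epot_ge_of_split {ρ : Space → ℝ} (h0 : ∀ x, 0 ≤ ρ x) (hi : Integrable ρ)
    (hsymm : ∀ x y : Space, ‖x‖ = ‖y‖ → ρ x = ρ y)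
    (hE : Integrable fun x : Space => ∫ y : Space, ρ x * ρ y / ‖x - y‖) {R : ℝ} (hR : 0 < R) :
    Epot ({x : Space | R ≤ ‖x‖}ᶜ.indicator ρ) -
      ((∫ x, ρ x) ^ 2 - (∫ x in {x : Space | R ≤ ‖x‖}ᶜ, ρ x) ^ 2) / (2 * R) ≤ Epot ρ := by
  set S : Set Space := {x | R ≤ ‖x‖} with hS
  have hSm : MeasurableSet S := measurableSet_le (by fun_prop) (by fun_prop)
  set ρ₁ := Sᶜ.indicator ρ with hρ₁
  set ρ₂ := S.indicator ρ with hρ₂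
  have hi₁ : Integrable ρ₁ := hi.indicator hSm.compl
  have hi₂ : Integrable ρ₂ := hi.indicator hSm
  have h0₁ : ∀ x, 0 ≤ ρ₁ x := Set.indicator_nonneg fun x _ => h0 x
  have h0₂ : ∀ x, 0 ≤ ρ₂ x := Set.indicator_nonneg fun x _ => h0 x
  have hsum : ∀ x, ρ x = ρ₁ x + ρ₂ x := fun x => by
    rw [hρ₁, hρ₂, add_comm]; exact (congrFun (Set.indicator_self_add_compl S ρ) x).symm
  have hsymm₁ : ∀ x y : Space, ‖x‖ = ‖y‖ → ρ₁ x = ρ₁ y := fun x y h => by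
    simp [hρ₁, hS, Set.indicator_apply, h, hsymm x y h]
  have hsymm₂ : ∀ x y : Space, ‖x‖ = ‖y‖ → ρ₂ x = ρ₂ y := fun x y h => by
    simp [hρ₂, hS, Set.indicator_apply, h, hsymm x y h]
  set a := ∫ x, ρ₁ x with ha
  set m := ∫ x, ρ₂ x with hm
  have ha' : ∫ x in Sᶜ, ρ x = a := (integral_indicator hSm.compl).symm
  have hM : ∫ x, ρ x = a + m := by
    rw [ha, hm, ← integral_add hi₁ hi₂]
    exact integral_congr_ae (Eventually.of_forall hsum)
  have ha0 : 0 ≤ a := integral_nonneg h0₁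
  have hm0 : 0 ≤ m := integral_nonneg h0₂
  have hpt : ∀ᵐ x : Space,
      (∫ y : Space, ρ₁ x * ρ₁ y / ‖x - y‖) ≤ (∫ y : Space, ρ x * ρ y / ‖x - y‖)
      ∧ (∫ y : Space, ρ x * ρ y / ‖x - y‖) ≤ (∫ y : Space, ρ₁ x * ρ₁ y / ‖x - y‖) +
        (ρ₁ x * (m / R) + ρ₂ x * (a / R + m / R)) := by
    filter_upwards [Measure.ae_ne volume 0] with x hx
    have hx0 : 0 < ‖x‖ := norm_pos_iff.2 hx
    obtain ⟨j₁, b₁⟩ := potential_bound h0₁ hi₁ hsymm₁ hx hx0 fun y _ => le_max_left _ _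
    obtain ⟨j₂, b₂⟩ := potential_bound h0₂ hi₂ hsymm₂ hx hR fun y hy =>
      le_max_of_le_right (by
        by_contra h
        exact hy (Set.indicator_of_notMem (s := S) h ρ))
    have hg : ∫ y : Space, ρ x * ρ y / ‖x - y‖ =
        ρ x * ((∫ y : Space, ρ₁ y / ‖x - y‖) + ∫ y : Space, ρ₂ y / ‖x - y‖) := by
      rw [← integral_add j₁ j₂, ← integral_const_mul]
      congr 1
      ext y
      rw [hsum y]
      ring
    have hg₁ : ∫ y : Space, ρ₁ x * ρ₁ y / ‖x - y‖ = ρ₁ x * ∫ y : Space, ρ₁ y / ‖x - y‖ := by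
      rw [← integral_const_mul]
      simp_rw [mul_div_assoc]
    have hn₁ : 0 ≤ ∫ y : Space, ρ₁ y / ‖x - y‖ :=
      integral_nonneg fun y => div_nonneg (h0₁ y) (norm_nonneg _)
    have hn₂ : 0 ≤ ∫ y : Space, ρ₂ y / ‖x - y‖ :=
      integral_nonneg fun y => div_nonneg (h0₂ y) (norm_nonneg _)
    rw [hg, hg₁]
    by_cases hxS : x ∈ S
    · have e₁ : ρ₁ x = 0 := Set.indicator_of_notMem (by simpa using hxS) ρ
      have e₂ : ρ x = ρ₂ x := by rw [hsum, e₁, zero_add]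
      have hxR : a / ‖x‖ ≤ a / R := div_le_div_of_nonneg_left ha0 hR hxS
      rw [e₁, e₂]
      refine ⟨?_, ?_⟩
      · rw [zero_mul]
        exact mul_nonneg (h0₂ x) (add_nonneg hn₁ hn₂)
      · simpa using mul_le_mul_of_nonneg_left (add_le_add (b₁.trans hxR) b₂) (h0₂ x)
    · have e₂ : ρ₂ x = 0 := Set.indicator_of_notMem hxS ρ
      have e₁ : ρ x = ρ₁ x := by rw [hsum, e₂, add_zero]
      rw [e₁, e₂, mul_add]
      exact ⟨le_add_of_nonneg_right (mul_nonneg (h0₁ x) hn₂),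
        by simpa using mul_le_mul_of_nonneg_left b₂ (h0₁ x)⟩
  have hmeas₁ : AEStronglyMeasurable fun x : Space => ∫ y : Space, ρ₁ x * ρ₁ y / ‖x - y‖ := by
    refine AEStronglyMeasurable.integral_prod_right' (f := fun p : Space × Space =>
      ρ₁ p.1 * ρ₁ p.2 / ‖p.1 - p.2‖) ?_
    exact (((hi₁.aestronglyMeasurable.comp_fst).mul
      (hi₁.aestronglyMeasurable.comp_snd)).aemeasurable.div
        (by fun_prop : Measurable fun p : Space × Space =>
          ‖p.1 - p.2‖).aemeasurable).aestronglyMeasurable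
  have hE₁ : Integrable fun x : Space => ∫ y : Space, ρ₁ x * ρ₁ y / ‖x - y‖ := by
    refine hE.mono' hmeas₁ ?_
    filter_upwards [hpt] with x hx
    rw [Real.norm_of_nonneg (integral_nonneg fun y =>
      div_nonneg (mul_nonneg (h0₁ x) (h0₁ y)) (norm_nonneg _))]
    exact hx.1
  have hrest : Integrable fun x : Space => ρ₁ x * (m / R) + ρ₂ x * (a / R + m / R) :=
    (hi₁.mul_const _).add (hi₂.mul_const _)
  have hfin := integral_mono_ae hE (hE₁.add hrest) (hpt.mono fun x hx => hx.2)
  rw [integral_add' hE₁ hrest, integral_add (hi₁.mul_const _) (hi₂.mul_const _),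
    integral_mul_const, integral_mul_const, ← ha, ← hm] at hfin
  rw [hM, ha']
  unfold Epot
  have halg : a * (m / R) + m * (a / R + m / R) = 2 * (((a + m) ^ 2 - a ^ 2) / (2 * R)) := by
    field_simp
    ring
  rw [halg] at hfin
  linarith

/-- Energy gap of a spherically symmetric density in terms of the mass outside radius `R ≥ R₀`. -/
lemma HCr_gap {Φ Φ' : ℝ → ℝ} {n n' : ℝ} (hΦ : PhiHyp Φ Φ' n n') {M : ℝ} (hM : 0 < M)
    (hbdd : BddBelow (HCr Φ '' FMr Φ M)) (hneg : hMr Φ M < 0) {ρ : Space → ℝ} (hρ : ρ ∈ FMr Φ M)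
    (hsymm : ∀ x y : Space, ‖x‖ = ‖y‖ → ρ x = ρ y) {R : ℝ} (hR0 : 0 < R0 Φ M) (hR : R0 Φ M ≤ R) :
    hMr Φ M - hMr Φ M * (5 / 6) * (1 - R0 Φ M / R) *
      (1 - ((M - ∫ x in {x : Space | R ≤ ‖x‖}, ρ x) / M) ^ 2) ≤ HCr Φ ρ := by
  have hRpos : 0 < R := hR0.trans_le hR
  obtain ⟨h0, hi, hΦi, hmass⟩ := hρ
  have hSm : MeasurableSet {x : Space | R ≤ ‖x‖} := measurableSet_le (by fun_prop) (by fun_prop)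
  have hadd := integral_add_compl hSm hi
  set m := ∫ x in {x : Space | R ≤ ‖x‖}, ρ x with hm
  set a := ∫ x in {x : Space | R ≤ ‖x‖}ᶜ, ρ x with ha
  have hm0 : 0 ≤ m := integral_nonneg h0
  have ha0 : 0 ≤ a := integral_nonneg h0
  have hma : M - m = a := by linarith
  rw [hma]
  set q := R0 Φ M / R with hq
  have hq0 : 0 < q := div_pos hR0 hRpos
  have hq1 : q ≤ 1 := (div_le_one hRpos).2 hR
  set h := hMr Φ M with hh
  have hu0 : 0 ≤ a / M := div_nonneg ha0 hM.le
  have hu1 : a / M ≤ 1 := (div_le_one hM).2 (by linarith)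
  have hP : 0 ≤ ∫ x, Φ (ρ x) := integral_nonneg fun x => hΦ.nonneg (h0 x)
  by_cases hE : Integrable fun x : Space => ∫ y : Space, ρ x * ρ y / ‖x - y‖
  · have hsplit := Epot_ge_of_split h0 hi hsymm hE hRpos
    rw [hmass, ← ha] at hsplit
    set ρ₁ := {x : Space | R ≤ ‖x‖}ᶜ.indicator ρ with hρ₁
    have hΦ₁ : (fun x => Φ (ρ₁ x)) = {x : Space | R ≤ ‖x‖}ᶜ.indicator fun x => Φ (ρ x) := by
      ext x
      by_cases hx : x ∈ {x : Space | R ≤ ‖x‖}ᶜ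
      · simp only [hρ₁, Set.indicator_of_mem hx]
      · simp only [hρ₁, Set.indicator_of_notMem hx, hΦ.zero]
    have hΦi₁ : Integrable fun x => Φ (ρ₁ x) := hΦ₁ ▸ hΦi.indicator hSm.compl
    have hP₁ : ∫ x, Φ (ρ₁ x) ≤ ∫ x, Φ (ρ x) := by
      refine integral_mono hΦi₁ hΦi fun x => ?_
      refine (congrFun hΦ₁ x).trans_le ?_
      exact Set.indicator_le_self' (fun _ _ => hΦ.nonneg (h0 x)) x
    have hint₁ : ∫ x, ρ₁ x = a := integral_indicator hSm.compl
    have h0₁ : ∀ x, 0 ≤ ρ₁ x := Set.indicator_nonneg fun x _ => h0 x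
    obtain ⟨b, hb0, hb1, hb3⟩ : ∃ b : ℝ, 0 ≤ b ∧ b ≤ 1 ∧ b ^ 3 = a / M := by
      have : (a / M) ∈ (fun b : ℝ => b ^ 3) '' Set.Icc 0 1 :=
        intermediate_value_Icc zero_le_one (by fun_prop) (by simpa using ⟨hu0, hu1⟩)
      obtain ⟨b, hb, hb'⟩ := this
      exact ⟨b, hb.1, hb.2, hb'⟩
    have hH₁ : b ^ 5 * h ≤ HCr Φ ρ₁ := by
      rcases hb0.eq_or_lt with rfl | hb
      · have haz : a = 0 := by
          have : a / M = 0 := by rw [← hb3]; norm_num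
          simpa [hM.ne'] using this
        have hz : ρ₁ =ᵐ[volume] 0 :=
          (integral_eq_zero_iff_of_nonneg h0₁ (hi.indicator hSm.compl)).1 (hint₁.trans haz)
        have hEz : Epot ρ₁ = 0 := by
          unfold Epot
          rw [integral_eq_zero_of_ae, mul_zero]
          filter_upwards [hz] with x hx
          simp [hx]
        have : 0 ≤ ∫ x, Φ (ρ₁ x) := integral_nonneg fun x => hΦ.nonneg (h0₁ x)
        simpa [HCr, hEz] using this
      · refine pow_five_mul_hMr_le (fun r => hΦ.nonneg) hbdd hb hb1
          ⟨h0₁, hi.indicator hSm.compl, hΦi₁, ?_⟩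
        rw [hint₁, hb3, div_mul_cancel₀ _ hM.ne']
    have hkey : (M ^ 2 - a ^ 2) / (2 * R) = -h * (5 / 6) * q * (1 - (b ^ 3) ^ 2) := by
      rw [hb3, hq, R0, ← hh]
      have := hneg.ne
      field_simp
      ring
    have hpoly : 0 ≤ 1 - b ^ 5 - 5 / 6 * (1 - (b ^ 3) ^ 2) := by
      have : 1 - b ^ 5 - 5 / 6 * (1 - (b ^ 3) ^ 2) =
          (1 - b) ^ 2 * (1 + 2 * b + 3 * b ^ 2 + 4 * b ^ 3 + 5 * b ^ 4) / 6 := by ring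
      rw [this]
      positivity
    rw [hkey] at hsplit
    rw [← hb3]
    unfold HCr at hH₁ ⊢
    nlinarith [mul_nonneg (neg_nonneg.2 hneg.le) hpoly]
  · have hEz : Epot ρ = 0 := by
      unfold Epot
      rw [integral_undef hE, mul_zero]
    unfold HCr
    rw [hEz, add_zero]
    refine le_trans ?_ hP
    have h1 : (1 - q) * (1 - (a / M) ^ 2) ≤ 1 :=
      mul_le_one₀ (by linarith) (by nlinarith) (by nlinarith)
    nlinarith

/-- Spherically symmetric concentration estimate: `R₀ > 0`; for every
spherically symmetric `ρ ∈ F_M^r`, `R > 0` and `m = ∫_{|x|≥R} ρ`, one has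
`H_C^r(ρ) ≥ h_M^r + (1/R₀ - 1/R)(M - m) m`; and for `R > R₀`, along any spherically
symmetric minimizing sequence, `∫_{|x|≥R} ρ_i → 0`. -/
theorem spherically_symmetric_concentration (Φ Φ' : ℝ → ℝ) (n n' : ℝ)
    (hΦ : PhiHyp Φ Φ' n n') (M : ℝ) (hM : 0 < M)
    (hbdd : BddBelow (HCr Φ '' FMr Φ M)) (hneg : hMr Φ M < 0) :
    0 < R0 Φ M ∧
    (∀ ρ ∈ FMr Φ M, (∀ x y : Space, ‖x‖ = ‖y‖ → ρ x = ρ y) → ∀ R : ℝ, 0 < R →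
      hMr Φ M + (1/(R0 Φ M) - 1/R) * (M - ∫ x in {x : Space | R ≤ ‖x‖}, ρ x) *
        (∫ x in {x : Space | R ≤ ‖x‖}, ρ x) ≤ HCr Φ ρ) ∧
    (∀ R : ℝ, R0 Φ M < R →
      ∀ ρ : ℕ → Space → ℝ, (∀ i, ρ i ∈ FMr Φ M) →
        (∀ i, ∀ x y : Space, ‖x‖ = ‖y‖ → ρ i x = ρ i y) →
        Tendsto (fun i => HCr Φ (ρ i)) atTop (nhds (hMr Φ M)) →
        Tendsto (fun i => ∫ x in {x : Space | R ≤ ‖x‖}, ρ i x) atTop (nhds 0)) := by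
  have hR0 : 0 < R0 Φ M := div_pos_of_neg_of_neg (by nlinarith [pow_pos hM 2]) hneg
  have hmass {ρ : Space → ℝ} (hρ : ρ ∈ FMr Φ M) (R : ℝ) :
      0 ≤ (∫ x in {x : Space | R ≤ ‖x‖}, ρ x) ∧ (∫ x in {x : Space | R ≤ ‖x‖}, ρ x) ≤ M := by
    refine ⟨integral_nonneg hρ.1, ?_⟩
    rw [← hρ.2.2.2]
    exact setIntegral_le_integral hρ.2.1 (Eventually.of_forall hρ.1)
  refine ⟨hR0, fun ρ hρ hsymm R hR => ?_, fun R hR ρ hρ hsymm hlim => ?_⟩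
  · obtain ⟨hm0, hmM⟩ := hmass hρ R
    rcases le_total R (R0 Φ M) with hle | hle
    · have h1 : hMr Φ M ≤ HCr Φ ρ := csInf_le hbdd ⟨ρ, hρ, rfl⟩
      have h2 := one_div_le_one_div_of_le hR hle
      have h3 := mul_nonneg (mul_nonneg (sub_nonneg.2 h2) (sub_nonneg.2 hmM)) hm0
      linarith
    · refine le_trans ?_ (HCr_gap hΦ hM hbdd hneg hρ hsymm hR0 hle)
      set m := ∫ x in {x : Space | R ≤ ‖x‖}, ρ x
      have hq1 : R0 Φ M / R ≤ 1 := (div_le_one hR).2 hle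
      have hid : (1 / R0 Φ M - 1 / R) * (M - m) * m =
          -hMr Φ M * (5 / 6) * (1 - R0 Φ M / R) * (2 * ((M - m) / M) * (1 - (M - m) / M)) := by
        have := hneg.ne
        unfold R0
        field_simp
        ring
      rw [hid]
      have h1 : 2 * ((M - m) / M) * (1 - (M - m) / M) ≤ 1 - ((M - m) / M) ^ 2 := by
        nlinarith [sq_nonneg (1 - (M - m) / M)]
      have h2 := mul_le_mul_of_nonneg_left h1
        (mul_nonneg (mul_nonneg (neg_nonneg.2 hneg.le) (by norm_num : (0 : ℝ) ≤ 5 / 6))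
          (sub_nonneg.2 hq1))
      linarith
  · have hRpos : 0 < R := hR0.trans hR
    have hq1 : R0 Φ M / R < 1 := (div_lt_one hRpos).2 hR
    set c := -hMr Φ M * (5 / 6) * (1 - R0 Φ M / R) with hc
    have hc0 : 0 < c :=
      mul_pos (mul_pos (neg_pos.2 hneg) (by norm_num)) (sub_pos.2 hq1)
    have hbound : ∀ i, (∫ x in {x : Space | R ≤ ‖x‖}, ρ i x) ≤
        M / c * (HCr Φ (ρ i) - hMr Φ M) := by
      intro i
      obtain ⟨hm0, hmM⟩ := hmass (hρ i) R
      have h1 := HCr_gap hΦ hM hbdd hneg (hρ i) (hsymm i) hR0 hR.le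
      set m := ∫ x in {x : Space | R ≤ ‖x‖}, ρ i x
      have hu : m / M ≤ 1 - ((M - m) / M) ^ 2 := by
        have e : (M - m) / M = 1 - m / M := by field_simp
        have h2 : 0 ≤ m / M := div_nonneg hm0 hM.le
        have h3 : m / M ≤ 1 := (div_le_one hM).2 hmM
        rw [e]
        nlinarith
      have h4 := mul_le_mul_of_nonneg_left hu hc0.le
      have h5 : c * (m / M) ≤ HCr Φ (ρ i) - hMr Φ M := by
        rw [hc] at h4 ⊢
        linarith
      calc m = M / c * (c * (m / M)) := by field_simp
        _ ≤ M / c * (HCr Φ (ρ i) - hMr Φ M) :=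
          mul_le_mul_of_nonneg_left h5 (div_pos hM hc0).le
    refine squeeze_zero (fun i => (hmass (hρ i) R).1) hbound ?_
    simpa using (hlim.sub_const (hMr Φ M)).const_mul (M / c)
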